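/- arXiv:cs/0606106 — 8 statements merged into one kernel-verified Lean document; each statement's English description precedes it below -/
import Mathlib

section
/- Let p be a prime, q = p^r, and n, m ≥ 1. (a) Every biadditive form f : GF(q^m)^n × GF(q^m)^n → GF(q^m) can be written as f((x₁,…,x_n),(y₁,…,y_n)) = Σ_{1≤i,j≤n} Σ_{0≤k,l≤rm−1} a_{ijkl} x_i^{p^k} y_j^{p^l} for some coefficients a_{ijkl} ∈ GF(q^m). (b) With these coefficients, the induced biadditive form satisfies f̃((x₁,…,x_{nm}),(y₁,…,y_{nm})) = Σ_{1≤i,j≤n} Σ_{0≤k,l≤r−1} Σ_{s=0}^{m−1} b_{ijkl} x_{sn+i}^{p^k} y_{sn+j}^{p^l}, where b_{ijkl} = Σ_{0≤u,v≤m−1} a_{ij(k+ur)(l+vr)}. -/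
open Finset in
/-- Splitting `{0, …, r * m - 1}` according to the residue modulo `r`. -/
theorem sum_range_mul_eq_sum_residue {M : Type*} [AddCommMonoid M] (r m : ℕ) (F : ℕ → M) :
    ∑ k ∈ range (r * m), F k = ∑ k ∈ range r, ∑ u ∈ range m, F (k + u * r) := by
  induction m with
  | zero => simp
  | succ m ih =>
    rw [Nat.mul_succ, sum_range_add, ih, ← sum_add_distrib]
    refine sum_congr rfl fun k _ ↦ ?_
    rw [sum_range_succ, add_comm (r * m), mul_comm r]

/-- Every additive endomorphism of a finite field is a combination of powers of Frobenius, with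
coefficients depending additively on the endomorphism. -/
theorem AddMonoidHom.exists_eq_sum_pow_char_pow {p N : ℕ} [Fact p.Prime] {L : Type*} [Field L]
    [Fintype L] (hL : Fintype.card L = p ^ N) :
    ∃ c : ℕ → (L →+ L) →+ L, ∀ (g : L →+ L) (x : L),
      g x = ∑ k ∈ Finset.range N, c k g * x ^ p ^ k := by
  have : CharP L p := by
    have h := FiniteField.cast_card_eq_zero L
    rw [hL, Nat.cast_pow] at h
    exact (CharP.charP_iff_prime_eq_zero Fact.out).2 (eq_zero_of_pow_eq_zero h)
  let := ZMod.algebra L p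
  have hfin : Module.finrank (ZMod p) L = N := by
    have h := Module.card_eq_pow_finrank (K := ZMod p) (V := L)
    rw [hL, ZMod.card] at h
    exact (Nat.pow_right_injective (Fact.out : p.Prime).two_le h).symm
  let φ : Fin (Module.finrank (ZMod p) L) → L →ₗ[ZMod p] L := fun k ↦
    (FiniteField.frobeniusAlgHom (ZMod p) L ^ k.1).toLinearMap
  have hφ : LinearIndependent L φ :=
    (linearIndependent_algHom_toLinearMap (ZMod p) L L).comp _
      (FiniteField.bijective_frobeniusAlgHom_pow (ZMod p) L).1
  let b := Module.Basis.mk hφ (hφ.span_eq_top_of_card_eq_finrank' (by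
    rw [Fintype.card_fin, Module.finrank_linearMap_self])).ge
  let c (k : ℕ) : (L →+ L) →+ L :=
    if h : k < Module.finrank (ZMod p) L then
      (b.coord ⟨k, h⟩).toAddMonoidHom.comp
        (AddMonoidHom.toZModLinearMapEquiv p : (L →+ L) ≃+ (L →ₗ[ZMod p] L)).toAddMonoidHom
    else 0
  refine ⟨c, fun g x ↦ ?_⟩
  have hx := congr($(b.sum_repr (g.toZModLinearMap p)) x)
  rw [← hfin, ← Fin.sum_univ_eq_sum_range (fun k ↦ c k g * x ^ p ^ k)]
  simpa [b, c, φ, LinearMap.sum_apply, AlgHom.coe_pow, FiniteField.coe_frobeniusAlgHom,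
    pow_iterate, ZMod.card] using! hx.symm

/-- A biadditive map on a finite field is a combination of products of powers of Frobenius. -/
theorem AddMonoidHom.exists_eq_sum_pow_char_pow₂ {p N : ℕ} [Fact p.Prime] {L : Type*} [Field L]
    [Fintype L] (hL : Fintype.card L = p ^ N) (B : L →+ L →+ L) :
    ∃ a : ℕ → ℕ → L, ∀ x y, B x y =
      ∑ k ∈ Finset.range N, ∑ l ∈ Finset.range N, a k l * x ^ p ^ k * y ^ p ^ l := by
  obtain ⟨c, hc⟩ := AddMonoidHom.exists_eq_sum_pow_char_pow hL
  refine ⟨fun k l ↦ c l ((c k).comp B.flip), fun x y ↦ ?_⟩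
  rw [← AddMonoidHom.flip_apply, hc]
  refine Finset.sum_congr rfl fun k _ ↦ ?_
  rw [← AddMonoidHom.comp_apply, hc, Finset.sum_mul]
  exact Finset.sum_congr rfl fun l _ ↦ mul_right_comm _ _ _

/-- In a field with `p ^ r` elements, the exponent of `p` in `x ^ p ^ k` only matters modulo `r`. -/
theorem FiniteField.pow_char_pow_add_mul {p r : ℕ} {K : Type*} [Field K] [Fintype K]
    (hK : Fintype.card K = p ^ r) (x : K) (k u : ℕ) : x ^ p ^ (k + u * r) = x ^ p ^ k := by
  rw [pow_add, mul_comm u, pow_mul p, ← hK, pow_mul, FiniteField.pow_card_pow]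

/-- Lemma 1 of the paper.
`K = GF(q)` and `L = GF(q^m)` with `q = p^r`.  Part (a): every biadditive form
`f : L^n × L^n → L` has a polynomial expansion
`f(x,y) = Σ_{i,j} Σ_{k,l < rm} a_{ijkl} x_i^{p^k} y_j^{p^l}`.
Part (b): with these coefficients, the induced form
`f̃(x,y) = Σ_s f(x_s, y_s)` (blocks embedded from `K` into `L`) equals
`Σ_{i,j} Σ_{k,l < r} Σ_s b_{ijkl} x_{s,i}^{p^k} y_{s,j}^{p^l}` where
`b_{ijkl} = Σ_{u,v < m} a_{ij(k+ur)(l+vr)}`. -/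
theorem stmt_0 (p r m n : ℕ) (hp : p.Prime) (hr : 1 ≤ r) (hm : 1 ≤ m) (hn : 1 ≤ n)
    (K L : Type) [Field K] [Field L] [Fintype K] [Fintype L] [Algebra K L]
    (hK : Fintype.card K = p ^ r) (hL : Fintype.card L = p ^ (r * m))
    (f : (Fin n → L) → (Fin n → L) → L)
    (hf₁ : ∀ x x' y, f (x + x') y = f x y + f x' y)
    (hf₂ : ∀ x y y', f x (y + y') = f x y + f x y') :
    ∃ a : Fin n → Fin n → ℕ → ℕ → L,
      (∀ x y : Fin n → L,
        f x y = ∑ i : Fin n, ∑ j : Fin n, ∑ k ∈ Finset.range (r * m),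
          ∑ l ∈ Finset.range (r * m), a i j k l * x i ^ p ^ k * y j ^ p ^ l) ∧
      (∀ x y : Fin m → Fin n → K,
        ∑ s : Fin m,
            f (fun i => algebraMap K L (x s i)) (fun i => algebraMap K L (y s i)) =
          ∑ i : Fin n, ∑ j : Fin n, ∑ k ∈ Finset.range r, ∑ l ∈ Finset.range r,
            ∑ s : Fin m,
              (∑ u ∈ Finset.range m, ∑ v ∈ Finset.range m,
                  a i j (k + u * r) (l + v * r)) *
                algebraMap K L (x s i) ^ p ^ k * algebraMap K L (y s j) ^ p ^ l) := by
  have : Fact p.Prime := ⟨hp⟩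
  let F : (Fin n → L) →+ (Fin n → L) →+ L :=
    AddMonoidHom.mk' (fun x ↦ AddMonoidHom.mk' (f x) (hf₂ x)) fun x x' ↦
      AddMonoidHom.ext (hf₁ x x')
  have hF (x y : Fin n → L) :
      f x y = ∑ i, ∑ j, F (Pi.single i (x i)) (Pi.single j (y j)) := by
    change F x y = _
    conv_lhs => rw [← Finset.univ_sum_single x, ← Finset.univ_sum_single y]
    simp only [map_sum, AddMonoidHom.finsetSum_apply]
    exact Finset.sum_comm
  choose a ha using fun i j ↦ AddMonoidHom.exists_eq_sum_pow_char_pow₂ hL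
    ((F.comp (AddMonoidHom.single (fun _ ↦ L) i)).compl₂ (AddMonoidHom.single (fun _ ↦ L) j))
  have hfa (x y : Fin n → L) : f x y = ∑ i : Fin n, ∑ j : Fin n, ∑ k ∈ Finset.range (r * m),
      ∑ l ∈ Finset.range (r * m), a i j k l * x i ^ p ^ k * y j ^ p ^ l := by
    rw [hF]
    exact Finset.sum_congr rfl fun i _ ↦ Finset.sum_congr rfl fun j _ ↦ ha i j (x i) (y j)
  refine ⟨a, hfa, fun x y ↦ ?_⟩
  have hpow (z : K) (k u : ℕ) :
      algebraMap K L z ^ p ^ (k + u * r) = algebraMap K L z ^ p ^ k := by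
    rw [← map_pow, FiniteField.pow_char_pow_add_mul hK, map_pow]
  simp_rw [hfa, sum_range_mul_eq_sum_residue r m, hpow]
  rw [Finset.sum_comm]
  refine Finset.sum_congr rfl fun i _ ↦ ?_
  rw [Finset.sum_comm]
  refine Finset.sum_congr rfl fun j _ ↦ ?_
  rw [Finset.sum_comm]
  refine Finset.sum_congr rfl fun k _ ↦ ?_
  simp_rw [Finset.sum_comm (s := Finset.range m) (t := Finset.range r)]
  rw [Finset.sum_comm]
  simp_rw [Finset.sum_mul]
end

section
/- Let Tr : GF(q^m) → GF(q) be the trace map and let a₀, a₁, …, a_{q−1} be elements of GF(q^m). Then Tr(a₀ + λa₁ + λ²a₂ + … + λ^{q−1}a_{q−1}) = 0 for all λ ∈ GF(q^m) if and only if Tr(a₀) = 0 and a₁ = a₂ = … = a_{q−1} = 0. -/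
open Polynomial in
/-- If `f(λ) = ∑ i < q, λ ^ i * a i` has trace zero for every `λ`, then its nonconstant
coefficients vanish. -/
theorem eq_zero_of_forall_trace_sum_pow_mul_eq_zero {K L : Type*} [Field K] [Field L] [Fintype K]
    [Finite L] [Algebra K L] {a : ℕ → L}
    (h : ∀ x : L, Algebra.trace K L (∑ i ∈ Finset.range (Fintype.card K), x ^ i * a i) = 0)
    {i : ℕ} (hi : 1 ≤ i) (hiq : i < Fintype.card K) : a i = 0 := by
  have := Fintype.ofFinite L
  set q := Fintype.card K
  set m := Module.finrank K L
  have hm0 : 0 < m := Module.finrank_pos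
  have hcard : Fintype.card L = q ^ m := Module.card_eq_pow_finrank
  let P : L[X] := ∑ j ∈ Finset.range m, ∑ k ∈ Finset.range q, monomial (k * q ^ j) (a k ^ q ^ j)
  have hdeg : P ∈ degreeLT L (q ^ m) := by
    refine Submodule.sum_mem _ fun j hj ↦ Submodule.sum_mem _ fun k hk ↦ ?_
    rw [Finset.mem_range] at hj hk
    rw [mem_degreeLT]
    refine (degree_monomial_le _ _).trans_lt ?_
    have hkj : k * q ^ j < q ^ m := calc
      k * q ^ j < q * q ^ j := Nat.mul_lt_mul_of_pos_right hk (pow_pos (by omega) _)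
      _ = q ^ (j + 1) := (pow_succ' _ _).symm
      _ ≤ q ^ m := Nat.pow_le_pow_right (by omega) hj
    exact_mod_cast hkj
  have heval (x : L) : P.eval x = 0 := by
    have hx := congrArg (algebraMap K L) (h x)
    rw [FiniteField.algebraMap_trace_eq_sum_pow, map_zero, Nat.card_eq_fintype_card] at hx
    rw [← hx]
    simp only [P, eval_finsetSum, eval_monomial]
    refine Finset.sum_congr rfl fun j _ ↦ ?_
    have hfrob := map_sum ((FiniteField.frobeniusAlgHom K L) ^ j) (fun k ↦ x ^ k * a k)
      (Finset.range q)
    simp only [AlgHom.coe_pow, FiniteField.coe_frobeniusAlgHom, pow_iterate] at hfrob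
    rw [hfrob]
    refine Finset.sum_congr rfl fun k _ ↦ ?_
    rw [mul_pow, ← pow_mul, mul_comm]
  have hP : P = 0 := by
    refine eq_zero_of_degree_lt_of_eval_finset_eq_zero Finset.univ ?_ fun x _ ↦ heval x
    rwa [Finset.card_univ, hcard, ← mem_degreeLT]
  have hcoeff : P.coeff i = a i := by
    simp only [P, finsetSum_coeff, coeff_monomial]
    rw [Finset.sum_eq_single_of_mem 0 (Finset.mem_range.2 hm0),
      Finset.sum_eq_single_of_mem i (Finset.mem_range.2 hiq)]
    · simp
    · intro k _ hk
      simp [hk]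
    · intro j _ hj
      refine Finset.sum_eq_zero fun k _ ↦ if_neg fun hkj ↦ ?_
      have hk : 0 < k := Nat.pos_of_ne_zero (by rintro rfl; omega)
      have : q ≤ k * q ^ j :=
        (Nat.le_self_pow hj q).trans (Nat.le_mul_of_pos_left _ hk)
      omega
  rw [← hcoeff, hP, coeff_zero]


/-- Lemma 2 of the paper.
For the trace map `Tr : GF(q^m) → GF(q)` and elements `a₀,…,a_{q-1}` of `GF(q^m)`:
`Tr(a₀ + λ a₁ + … + λ^{q-1} a_{q-1}) = 0` for all `λ` iff `Tr(a₀) = 0` and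
`a₁ = … = a_{q-1} = 0`. -/
theorem stmt_1 (q m : ℕ) (hq : IsPrimePow q) (hm : 1 ≤ m)
    (K L : Type) [Field K] [Field L] [Fintype K] [Fintype L] [Algebra K L]
    (hK : Fintype.card K = q) (hL : Fintype.card L = q ^ m)
    (a : ℕ → L) :
    (∀ lam : L, Algebra.trace K L (∑ i ∈ Finset.range q, lam ^ i * a i) = 0) ↔
      (Algebra.trace K L (a 0) = 0 ∧ ∀ i, 1 ≤ i → i < q → a i = 0) := by
  subst hK
  have h0 : 0 < Fintype.card K := Fintype.card_pos
  constructor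
  · intro h
    refine ⟨?_, fun i hi hiq ↦ eq_zero_of_forall_trace_sum_pow_mul_eq_zero h hi hiq⟩
    have h₀ := h 0
    rwa [Finset.sum_eq_single_of_mem 0 (Finset.mem_range.2 h0), pow_zero, one_mul] at h₀
    intro i _ hi
    rw [zero_pow hi, zero_mul]
  · rintro ⟨htr, ha⟩ x
    rwa [Finset.sum_eq_single_of_mem 0 (Finset.mem_range.2 h0), pow_zero, one_mul]
    intro i hi hi0
    rw [ha i (Nat.pos_of_ne_zero hi0) (Finset.mem_range.1 hi), mul_zero]
end

section
/- Let C be a scalable code of length n over GF(q^m) with q = p^r (p prime), and fix 0 ≤ l ≤ r−1. Then Tr(C) is self-orthogonal with respect to the Hermitian-type product h_l(x,y) = Σ_{i=1}^{n} x_i y_i^{p^l} on GF(q)^n if and only if Σ_{i=1}^n x_i y_i^{p^l q^k} = 0 for all x = (x₁,…,x_n), y = (y₁,…,y_n) ∈ C and all 0 ≤ k ≤ m−1, i.e., if and only if C is self-orthogonal with respect to every Hermitian-type product f_{kl}(x,y) = Σ_i x_i y_i^{p^l q^k}, 0 ≤ k ≤ m−1. -/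
/-- A polynomial function supported on distinct exponents below the cardinality of a finite field
vanishes identically only if all its coefficients are zero. -/
theorem coeff_eq_zero_of_sum_mul_pow_eq_zero {L : Type*} [Field L] [Fintype L] {s : Finset ℕ}
    {e : ℕ → ℕ} (he : Set.InjOn e s) (hlt : ∀ k ∈ s, e k < Fintype.card L) (a : ℕ → L)
    (h : ∀ d : L, ∑ k ∈ s, a k * d ^ e k = 0) : ∀ k ∈ s, a k = 0 := by
  intro k hk
  set P : Polynomial L := ∑ j ∈ s, Polynomial.monomial (e j) (a j) with hP
  have hzero : P = 0 := by
    refine Polynomial.eq_zero_of_natDegree_lt_card_of_eval_eq_zero P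
      (f := (id : L → L)) Function.injective_id (fun d => ?_) ?_
    · simpa [hP, Polynomial.eval_finsetSum] using h d
    · have hdeg : P.natDegree ≤ Fintype.card L - 1 :=
        Polynomial.natDegree_sum_le_of_forall_le s _ fun j hj =>
          (Polynomial.natDegree_monomial_le _).trans (Nat.le_sub_one_of_lt (hlt j hj))
      have : 0 < Fintype.card L := Fintype.card_pos
      omega
  have hcoeff : P.coeff (e k) = a k := by
    rw [hP, Polynomial.finsetSum_coeff, Finset.sum_eq_single_of_mem k hk]
    · simp
    · intro j hj hjk
      exact Polynomial.coeff_monomial_of_ne _ fun heq => hjk (he hj hk heq.symm)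
  rw [← hcoeff, hzero, Polynomial.coeff_zero]

/-- An element of a finite separable extension whose multiples all have trace zero is zero. -/
theorem eq_zero_of_forall_trace_mul_eq_zero {K L : Type*} [Field K] [Field L] [Algebra K L]
    [FiniteDimensional K L] [Algebra.IsSeparable K L] {a : L}
    (h : ∀ c : L, Algebra.trace K L (c * a) = 0) : a = 0 := by
  refine (traceForm_nondegenerate K L).1 a fun c => ?_
  rw [Algebra.traceForm_apply, mul_comm]
  exact h c

/-- The trace of a finite field, raised to a power of the characteristic, as a power sum. -/
theorem algebraMap_trace_pow_eq_sum_pow {p q m l : ℕ} [Fact p.Prime] {K L : Type*} [Field K]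
    [Field L] [Fintype K] [Fintype L] [Algebra K L] [CharP L p]
    (hK : Fintype.card K = q) (hL : Fintype.card L = q ^ m) (z : L) :
    algebraMap K L (Algebra.trace K L z ^ p ^ l) =
      ∑ k ∈ Finset.range m, z ^ (p ^ l * q ^ k) := by
  have hfin : Module.finrank K L = m := by
    have hcard := Module.card_eq_pow_finrank (K := K) (V := L)
    rw [hL, hK] at hcard
    exact (Nat.pow_right_injective (hK ▸ Fintype.one_lt_card) hcard).symm
  rw [map_pow, FiniteField.algebraMap_trace_eq_sum_pow, hfin, Nat.card_eq_fintype_card, hK,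
    sum_pow_char_pow]
  exact Finset.sum_congr rfl fun k _ => by rw [← pow_mul, mul_comm]


/-- Theorem 7 of the paper.  `K = GF(q)`, `L = GF(q^m)`, `q = p^r`,
`C` a scalable code of length `n` over `L`, and `0 ≤ l ≤ r-1`.  Then `Tr(C)` is
self-orthogonal w.r.t. the Hermitian-type product `Σ_{i=1}^n x_i y_i^{p^l}` iff
`Σ_i x_i y_i^{p^l q^k} = 0` for all `x,y ∈ C` and `0 ≤ k ≤ m-1`, i.e. iff `C` is
self-orthogonal w.r.t. every Hermitian-type product `f_{kl}`. -/
theorem stmt_7 (p r m n : ℕ) (hp : p.Prime) (hr : 0 < r) (hm : 0 < m)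
    (K L : Type) [Field K] [Field L] [Fintype K] [Fintype L] [Algebra K L]
    (hK : Fintype.card K = p ^ r) (hL : Fintype.card L = (p ^ r) ^ m)
    (C : Set (Fin n → L)) (hC : ∀ c : L, ∀ x ∈ C, c • x ∈ C)
    (l : ℕ) (hl : l < r) :
    (∀ x ∈ C, ∀ y ∈ C,
        ∑ i : Fin n,
          Algebra.trace K L (x i) * Algebra.trace K L (y i) ^ p ^ l = 0) ↔
    (∀ x ∈ C, ∀ y ∈ C, ∀ k ∈ Finset.range m,
        ∑ i : Fin n, x i * y i ^ (p ^ l * (p ^ r) ^ k) = 0) := by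
  have : Fact p.Prime := ⟨hp⟩
  have : CharP L p := charP_of_card_eq_prime_pow (f := r * m) (by rw [hL, pow_mul])
  have hsum : ∀ x y : Fin n → L,
      ∑ i, x i * algebraMap K L (Algebra.trace K L (y i) ^ p ^ l) =
        ∑ k ∈ Finset.range m, ∑ i, x i * y i ^ (p ^ l * (p ^ r) ^ k) := by
    intro x y
    simp_rw [algebraMap_trace_pow_eq_sum_pow hK hL, Finset.mul_sum]
    exact Finset.sum_comm
  have htrace : ∀ (c : L) (x y : Fin n → L),
      Algebra.trace K L
          (c * ∑ i, x i * algebraMap K L (Algebra.trace K L (y i) ^ p ^ l)) =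
        ∑ i, Algebra.trace K L (c * x i) * Algebra.trace K L (y i) ^ p ^ l := by
    intro c x y
    rw [Finset.mul_sum, map_sum]
    refine Finset.sum_congr rfl fun i _ => ?_
    rw [← mul_assoc, mul_comm, ← Algebra.smul_def, map_smul, smul_eq_mul, mul_comm]
  constructor
  · intro h x hx y hy
    refine coeff_eq_zero_of_sum_mul_pow_eq_zero (e := fun k => p ^ l * (p ^ r) ^ k) ?_ ?_
      (fun k => ∑ i, x i * y i ^ (p ^ l * (p ^ r) ^ k)) fun d => ?_
    · intro j _ k _ hjk
      exact Nat.pow_right_injective (Nat.one_lt_pow hr.ne' hp.one_lt)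
        (Nat.eq_of_mul_eq_mul_left (pow_pos hp.pos l) hjk)
    · intro k hk
      rw [hL]
      calc p ^ l * (p ^ r) ^ k < p ^ r * (p ^ r) ^ k :=
            Nat.mul_lt_mul_of_pos_right (Nat.pow_lt_pow_right hp.one_lt hl)
              (pow_pos (pow_pos hp.pos r) k)
        _ = (p ^ r) ^ (k + 1) := (pow_succ' _ _).symm
        _ ≤ (p ^ r) ^ m :=
            Nat.pow_le_pow_right (pow_pos hp.pos r) (Finset.mem_range.mp hk)
    · have hzero : ∑ i, x i * algebraMap K L (Algebra.trace K L ((d • y) i) ^ p ^ l) = 0 :=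
        eq_zero_of_forall_trace_mul_eq_zero (K := K) fun c =>
          (htrace c x (d • y)).trans (h _ (hC c x hx) _ (hC d y hy))
      rw [hsum] at hzero
      rw [← hzero]
      refine Finset.sum_congr rfl fun k _ => ?_
      rw [Finset.sum_mul]
      refine Finset.sum_congr rfl fun i _ => ?_
      rw [Pi.smul_apply, smul_eq_mul, mul_pow]
      ring
  · intro h x hx y hy
    have hxy := htrace 1 x y
    rw [hsum, Finset.sum_eq_zero (h x hx y hy), mul_zero, map_zero] at hxy
    simpa only [one_mul] using hxy.symm
end

section
/- Let q = 2^r and let l ≥ 0 be an integer. Then every root of the equation X^{1+2^l} + 1 = 0 lying in GF(q²) lies in GF(q) — equivalently, the power sum α^{1+2^l} + β^{1+2^l} is nonzero for every basis {α,β} of GF(q²) over GF(q) — if and only if gcd(2^l + 1, 2^r + 1) = 1. -/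
namespace FiniteField

open Polynomial in
/-- The image of a finite field `K` in an extension field is the fixed set of `x ↦ x ^ #K`. -/
theorem mem_range_algebraMap_iff_pow_card_eq {K L : Type*} [Field K] [Field L] [Fintype K]
    [Algebra K L] {x : L} :
    x ∈ Set.range (algebraMap K L) ↔ x ^ Fintype.card K = x := by
  constructor
  · rintro ⟨a, rfl⟩
    rw [← map_pow, FiniteField.pow_card]
  · intro hx
    have hroots := roots_X_pow_card_sub_X K
    have hmap := roots_map_of_injective_of_card_eq_natDegree (algebraMap K L).injective
      (p := (X ^ Fintype.card K - X : K[X])) (by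
        rw [hroots, X_pow_card_sub_X_natDegree_eq K Fintype.one_lt_card]
        rfl)
    have hne := X_pow_card_sub_X_ne_zero L (Fintype.one_lt_card (α := K))
    have hmem : x ∈ (X ^ Fintype.card K - X : L[X]).roots := by
      rw [mem_roots hne]
      simp [hx]
    rw [hroots] at hmap
    simp only [Polynomial.map_sub, Polynomial.map_pow, map_X] at hmap
    rw [← hmap] at hmem
    simpa using hmem

/-- In a quadratic extension of a finite field of even order, all `n`-th roots of unity lie in the
base field exactly when `n` is coprime to `#K + 1`. -/
theorem forall_pow_eq_one_mem_range_iff_coprime {K L : Type*} [Field K] [Field L] [Fintype K]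
    [Fintype L] [Algebra K L] (hK : Even (Fintype.card K))
    (hL : Fintype.card L = Fintype.card K ^ 2) {n : ℕ} (hn : n ≠ 0) :
    (∀ x : L, x ^ n = 1 → x ∈ Set.range (algebraMap K L)) ↔
      Nat.Coprime n (Fintype.card K + 1) := by
  obtain ⟨m, hm⟩ : ∃ m, Fintype.card K = m + 1 := Nat.exists_eq_add_one.2 Fintype.card_pos
  have hcard : Fintype.card L - 1 = (Fintype.card K + 1) * m := by
    rw [hL, hm, Nat.sub_eq_iff_eq_add (Nat.one_le_pow 2 (m + 1) m.succ_pos)]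
    ring
  constructor
  · intro h
    refine Nat.Coprime.symm (Nat.coprime_of_dvd fun p hp hpq hpn ↦ ?_)
    have : Fact p.Prime := ⟨hp⟩
    obtain ⟨u, hu⟩ := exists_prime_orderOf_dvd_card' (G := Lˣ) p (by
      rw [Nat.card_units, Nat.card_eq_fintype_card, hcard]
      exact hpq.mul_right m)
    have hun : (u : L) ^ n = 1 := by
      rw [← Units.val_pow_eq_pow_val, orderOf_dvd_iff_pow_eq_one.1 (hu ▸ hpn), Units.val_one]
    have hfix := mem_range_algebraMap_iff_pow_card_eq.1 (h u hun)
    have hum : u ^ m = 1 := by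
      rw [hm, pow_succ] at hfix
      exact Units.ext (by simpa using hfix)
    have hpm : p ∣ m := hu ▸ orderOf_dvd_of_pow_eq_one hum
    have hp2 : p ∣ 2 := by
      have := Nat.dvd_sub hpq hpm
      rwa [hm, show m + 1 + 1 - m = 2 by omega] at this
    have : 2 ∣ Fintype.card K + 1 := (Nat.prime_dvd_prime_iff_eq hp Nat.prime_two).1 hp2 ▸ hpq
    have := hK.two_dvd
    omega
  · intro h x hx
    have hx0 : x ≠ 0 := by
      rintro rfl
      simp [hn] at hx
    have hdvd : orderOf x ∣ (Fintype.card K + 1) * m :=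
      hcard ▸ orderOf_dvd_of_pow_eq_one (FiniteField.pow_card_sub_one_eq_one x hx0)
    have hxm : orderOf x ∣ m :=
      (h.coprime_dvd_left (orderOf_dvd_of_pow_eq_one hx)).dvd_of_dvd_mul_left hdvd
    rw [mem_range_algebraMap_iff_pow_card_eq, hm, pow_succ, orderOf_dvd_iff_pow_eq_one.1 hxm,
      one_mul]

end FiniteField

/-- Over every independent pair the power sum of exponent `n` is nonzero exactly when all roots of
`X ^ n + 1` come from the base field. -/
theorem forall_linearIndependent_pow_add_pow_ne_zero_iff {K L : Type*} [Field K] [Field L]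
    [Algebra K L] {n : ℕ} :
    (∀ α β : L, LinearIndependent K ![α, β] → α ^ n + β ^ n ≠ 0) ↔
      ∀ x : L, x ^ n + 1 = 0 → x ∈ Set.range (algebraMap K L) := by
  constructor
  · intro h x hx
    by_contra hmem
    refine h 1 x ((LinearIndependent.pair_iff' one_ne_zero).2 fun a ha ↦ hmem ⟨a, ?_⟩) ?_
    · rw [Algebra.algebraMap_eq_smul_one, ha]
    · rw [one_pow, add_comm, hx]
  · intro h α β hαβ hsum
    have hα : α ≠ 0 := hαβ.ne_zero 0
    obtain ⟨a, ha⟩ := h (β / α) (by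
      rw [div_pow, div_add_one (pow_ne_zero n hα), add_comm, hsum, zero_div])
    refine (LinearIndependent.pair_iff' hα).1 hαβ a ?_
    rw [Algebra.smul_def, ha, div_mul_cancel₀ β hα]


/-- Proposition 5(i) of the paper.  `q = 2^r`, `K = GF(q)`,
`L = GF(q²)`, `l ≥ 0`.  Every root of `X^{1+2^l} + 1 = 0` lying in `GF(q²)` lies in
`GF(q)` — equivalently, `α^{1+2^l} + β^{1+2^l} ≠ 0` for every basis `{α,β}` of
`GF(q²)` over `GF(q)` — iff `gcd(2^l + 1, 2^r + 1) = 1`. -/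
theorem stmt_13 (r l : ℕ) (hr : 0 < r)
    (K L : Type) [Field K] [Field L] [Fintype K] [Fintype L] [Algebra K L]
    (hK : Fintype.card K = 2 ^ r) (hL : Fintype.card L = (2 ^ r) ^ 2) :
    ((∀ x : L, x ^ (1 + 2 ^ l) + 1 = 0 → x ∈ Set.range (algebraMap K L)) ↔
        Nat.gcd (2 ^ l + 1) (2 ^ r + 1) = 1) ∧
    ((∀ α β : L, LinearIndependent K ![α, β] →
        α ^ (1 + 2 ^ l) + β ^ (1 + 2 ^ l) ≠ 0) ↔
      Nat.gcd (2 ^ l + 1) (2 ^ r + 1) = 1) := by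
  have hchar : (2 : L) = 0 := by
    have := FiniteField.cast_card_eq_zero L
    rw [hL] at this
    simpa [hr.ne'] using this
  have hneg : (-1 : L) = 1 := by
    rw [neg_eq_iff_add_eq_zero, one_add_one_eq_two, hchar]
  have key : (∀ x : L, x ^ (1 + 2 ^ l) + 1 = 0 → x ∈ Set.range (algebraMap K L)) ↔
      Nat.gcd (2 ^ l + 1) (2 ^ r + 1) = 1 := by
    have := FiniteField.forall_pow_eq_one_mem_range_iff_coprime (K := K) (L := L)
      (n := 1 + 2 ^ l) (hK ▸ (even_two.pow_of_ne_zero hr.ne')) (hK ▸ hL) (by positivity)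
    rw [hK, add_comm 1 (2 ^ l), Nat.coprime_iff_gcd_eq_one] at this
    simpa only [add_comm 1 (2 ^ l), add_eq_zero_iff_eq_neg, hneg] using this
  exact ⟨key, forall_linearIndependent_pow_add_pow_ne_zero_iff.trans key⟩
end

section
/- Let p be an odd prime, q = p^r, and l ≥ 0 an integer. Then every root of the equation X^{1+p^l} + 1 = 0 lying in GF(q²) lies in GF(q) — equivalently, the power sum α^{1+p^l} + β^{1+p^l} is nonzero for every basis {α,β} of GF(q²) over GF(q) — if and only if either (a) there is a power of two which divides p^r − 1 but does not divide p^l + 1, and gcd(p^l + 1, p^r + 1) = 2, or (b) every power of two dividing p^{2r} − 1 divides p^l + 1. -/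
/-- An element of an extension of a finite field `K` lies in `K` as soon as it is fixed by the
Frobenius map `x ↦ x ^ #K`. -/
theorem mem_range_algebraMap_of_pow_card_eq {K L : Type*} [Field K] [Field L] [Fintype K]
    [Algebra K L] {x : L} (hx : x ^ Fintype.card K = x) : x ∈ Set.range (algebraMap K L) := by
  classical
  by_contra hn
  have hne : (Polynomial.X ^ Fintype.card K - Polynomial.X : Polynomial L) ≠ 0 :=
    FiniteField.X_pow_card_sub_X_ne_zero L Fintype.one_lt_card
  have hsub : (insert x (Finset.univ.image (algebraMap K L))).val ⊆
      (Polynomial.X ^ Fintype.card K - Polynomial.X : Polynomial L).roots := by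
    intro y hy
    rw [Polynomial.mem_roots hne, Polynomial.IsRoot.def]
    simp only [Polynomial.eval_sub, Polynomial.eval_pow, Polynomial.eval_X, sub_eq_zero]
    rw [Finset.mem_val, Finset.mem_insert, Finset.mem_image] at hy
    rcases hy with rfl | ⟨a, -, rfl⟩
    · exact hx
    · rw [← map_pow, FiniteField.pow_card]
  have hcard := Polynomial.card_le_degree_of_subset_roots hsub
  rw [FiniteField.X_pow_card_sub_X_natDegree_eq L Fintype.one_lt_card,
    Finset.card_insert_of_notMem (by simpa using hn),
    Finset.card_image_of_injective _ (algebraMap K L).injective, Finset.card_univ] at hcard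
  omega

theorem FiniteField.exists_orderOf_eq {L : Type*} [Field L] [Fintype L] {d : ℕ}
    (hd : d ∣ Fintype.card L - 1) : ∃ z : L, orderOf z = d := by
  classical
  obtain ⟨g, hg⟩ := IsCyclic.exists_ofOrder_eq_natCard (α := Lˣ)
  rw [Nat.card_eq_fintype_card, Fintype.card_units] at hg
  have hN : Fintype.card L - 1 ≠ 0 := by
    have := Fintype.one_lt_card (α := L)
    omega
  obtain ⟨c, hc⟩ := hd
  have hc0 : c ≠ 0 := by
    rintro rfl
    exact hN (by simpa using hc)
  refine ⟨((g ^ c : Lˣ) : L), ?_⟩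
  rw [orderOf_units, orderOf_pow_of_dvd hc0 (hg ▸ hc ▸ Dvd.intro_left d rfl), hg, hc,
    Nat.mul_div_cancel _ (Nat.pos_of_ne_zero hc0)]

/-- If `x ^ b = -1 ≠ 1`, the exponents `a` with `x ^ a = -1` are no more divisible by two
than `b`. -/
theorem two_pow_dvd_of_pow_eq_neg_one {L : Type*} [Ring L] (h1 : (-1 : L) ≠ 1) {x : L}
    {a b t : ℕ} (ha : x ^ a = -1) (hb : x ^ b = -1) (ht : 2 ^ t ∣ a) : 2 ^ t ∣ b := by
  have hb0 : b ≠ 0 := by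
    rintro rfl
    exact h1 (by simpa using hb.symm)
  obtain ⟨e, w, hw, rfl⟩ := Nat.exists_eq_two_pow_mul_odd hb0
  rcases le_or_gt t e with hte | hte
  · exact Dvd.dvd.mul_right (pow_dvd_pow 2 hte) w
  · obtain ⟨c, rfl⟩ := (pow_dvd_pow 2 hte).trans ht
    refine absurd ?_ h1
    calc (-1 : L) = (x ^ (2 ^ (e + 1) * c)) ^ w := by rw [ha, hw.neg_one_pow]
      _ = (x ^ (2 ^ e * w)) ^ (2 * c) := by rw [← pow_mul, ← pow_mul]; ring_nf
      _ = 1 := by rw [hb, pow_mul]; simp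

/-- In odd characteristic, an element of order `2 ^ (e + 1)` satisfies `z ^ n = -1` for every
odd multiple `n` of `2 ^ e`. -/
theorem pow_eq_neg_one_of_orderOf_eq {L : Type*} [Ring L] [IsDomain L] {z : L} {e w : ℕ}
    (hz : orderOf z = 2 ^ (e + 1)) (hw : Odd w) : z ^ (2 ^ e * w) = -1 := by
  have hsq : (z ^ 2 ^ e) ^ 2 = 1 := by
    rw [← pow_mul, ← pow_succ, ← hz, pow_orderOf_eq_one]
  have hne : z ^ 2 ^ e ≠ 1 := by
    intro h
    have := Nat.le_of_dvd (by positivity) (orderOf_dvd_of_pow_eq_one h)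
    rw [hz] at this
    exact absurd this (not_le.mpr (Nat.pow_lt_pow_right one_lt_two (Nat.lt_succ_self e)))
  rw [pow_mul, (sq_eq_one_iff.mp hsq).resolve_left hne, hw.neg_one_pow]

theorem roots_mem_range_iff {K L : Type*} [Field K] [Field L] [Fintype K] [Fintype L]
    [Algebra K L] {q n : ℕ} (hq : Odd q) (hn : Even n) (hn0 : n ≠ 0)
    (hK : Fintype.card K = q) (hL : Fintype.card L = q ^ 2) :
    (∀ x : L, x ^ n = -1 → x ∈ Set.range (algebraMap K L)) ↔
      (((∃ t : ℕ, 2 ^ t ∣ q - 1 ∧ ¬ 2 ^ t ∣ n) ∧ Nat.gcd n (q + 1) = 2) ∨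
        (∀ t : ℕ, 2 ^ t ∣ q ^ 2 - 1 → 2 ^ t ∣ n)) := by
  have hq1 : 1 < q := hK ▸ Fintype.one_lt_card
  have hN : q ^ 2 - 1 = (q + 1) * (q - 1) := by simpa using Nat.sq_sub_sq q 1
  have hN0 : q ^ 2 - 1 ≠ 0 := by
    rw [hN]
    exact mul_ne_zero (by omega) (by omega)
  have hchar : (-1 : L) ≠ 1 := by
    apply Ring.neg_one_ne_one_of_char_ne_two
    intro h2
    have := FiniteField.even_card_of_char_two h2
    rw [hL] at this
    exact absurd (Nat.odd_iff.mp (hq.pow (n := 2))) (by omega)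
  have hne : ∀ x : L, x ^ n = -1 → x ≠ 0 := by
    rintro x hx rfl
    rw [zero_pow hn0] at hx
    simp at hx
  have hrange : ∀ x : L, x ≠ 0 → x ∈ Set.range (algebraMap K L) → x ^ (q - 1) = 1 := by
    rintro _ hx ⟨a, rfl⟩
    rw [← map_pow, ← hK, FiniteField.pow_card_sub_one_eq_one a (by rintro rfl; simp at hx),
      map_one]
  constructor
  · intro h
    rw [or_iff_not_imp_right]
    intro hb
    push Not at hb
    obtain ⟨t, ht, htn⟩ := hb
    obtain ⟨e, w, hw, rfl⟩ := Nat.exists_eq_two_pow_mul_odd hn0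
    have het : e + 1 ≤ t := by
      by_contra hlt
      exact htn (Dvd.dvd.mul_right (pow_dvd_pow 2 (by omega)) w)
    obtain ⟨z, hz⟩ := FiniteField.exists_orderOf_eq (L := L) (d := 2 ^ (e + 1))
      (hL ▸ (pow_dvd_pow 2 het).trans ht)
    have hroot := pow_eq_neg_one_of_orderOf_eq hz hw
    have hzq := hrange z (hne z hroot) (h z hroot)
    refine ⟨⟨e + 1, hz ▸ orderOf_dvd_of_pow_eq_one hzq, ?_⟩, ?_⟩
    · rw [pow_succ, Nat.mul_dvd_mul_iff_left (by positivity)]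
      exact hw.not_two_dvd_nat
    · set n := 2 ^ e * w
      set G := Nat.gcd n (q + 1) with hG
      obtain ⟨y, hy⟩ := FiniteField.exists_orderOf_eq (L := L) (d := G)
        (hL ▸ hN ▸ (Nat.gcd_dvd_right n (q + 1)).mul_right _)
      have hyn : y ^ n = 1 := orderOf_dvd_iff_pow_eq_one.mp (hy ▸ Nat.gcd_dvd_left n (q + 1))
      have hzy : (z * y) ^ n = -1 := by rw [mul_pow, hroot, hyn, mul_one]
      have hzyq := hrange _ (hne _ hzy) (h _ hzy)
      rw [mul_pow, hzq, one_mul] at hzyq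
      have hGq : G ∣ q - 1 := hy ▸ orderOf_dvd_of_pow_eq_one hzyq
      have hG2 : G ∣ 2 := by
        have := Nat.dvd_sub (Nat.gcd_dvd_right n (q + 1)) hGq
        rwa [show q + 1 - (q - 1) = 2 by omega] at this
      exact Nat.dvd_antisymm hG2
        (Nat.dvd_gcd hn.two_dvd (hq.add_one).two_dvd)
  · rintro (⟨⟨t, ht, htn⟩, hgcd⟩ | hb) x hx
    · have hx0 := hne x hx
      have hy1 : (x ^ (q - 1)) ^ n = 1 := by
        rw [← pow_mul, mul_comm, pow_mul, hx, (Nat.Odd.sub_odd hq odd_one).neg_one_pow]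
      have hy2 : (x ^ (q - 1)) ^ (q + 1) = 1 := by
        rw [← pow_mul, mul_comm, ← hN, ← hL, FiniteField.pow_card_sub_one_eq_one x hx0]
      have hy : (x ^ (q - 1)) ^ 2 = 1 := by
        rw [← hgcd]
        exact pow_gcd_eq_one.mpr ⟨hy1, hy2⟩
      rcases sq_eq_one_iff.mp hy with h1 | h1
      · apply mem_range_algebraMap_of_pow_card_eq
        rw [hK, show q = q - 1 + 1 by omega, pow_succ, h1, one_mul]
      · exact absurd (two_pow_dvd_of_pow_eq_neg_one hchar h1 hx ht) htn
    · obtain ⟨s, u, hu, hsu⟩ := Nat.exists_eq_two_pow_mul_odd hN0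
      obtain ⟨c, hc⟩ := hb s (hsu ▸ Nat.dvd_mul_right _ _)
      refine absurd ?_ hchar
      calc (-1 : L) = (x ^ n) ^ u := by rw [hx, hu.neg_one_pow]
        _ = (x ^ (Fintype.card L - 1)) ^ c := by
          rw [hL, hsu, hc, ← pow_mul, ← pow_mul]
          ring_nf
        _ = 1 := by rw [FiniteField.pow_card_sub_one_eq_one x (hne x hx), one_pow]

theorem add_pow_ne_zero_of_linearIndependent_iff {K L : Type*} [Field K] [Field L] [Algebra K L]
    (n : ℕ) :
    (∀ α β : L, LinearIndependent K ![α, β] → α ^ n + β ^ n ≠ 0) ↔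
      ∀ x : L, x ^ n + 1 = 0 → x ∈ Set.range (algebraMap K L) := by
  constructor
  · intro h x hx
    by_contra hxK
    refine h 1 x ?_ (by rw [one_pow, add_comm, hx])
    rw [LinearIndependent.pair_iff' one_ne_zero]
    intro a ha
    exact hxK ⟨a, by rw [Algebra.algebraMap_eq_smul_one, ha]⟩
  · intro h α β hli hsum
    have hα : α ≠ 0 := hli.ne_zero 0
    obtain ⟨a, ha⟩ := h (β / α) (by
      rw [div_pow, div_add_one (pow_ne_zero n hα), add_comm, hsum, zero_div])
    refine (LinearIndependent.pair_iff' hα).mp hli a ?_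
    rw [Algebra.smul_def, ha, div_mul_cancel₀ _ hα]


/-- Proposition 5(ii) of the paper.  `p` an odd prime, `q = p^r`,
`K = GF(q)`, `L = GF(q²)`, `l ≥ 0`.  Every root of `X^{1+p^l} + 1 = 0` lying in
`GF(q²)` lies in `GF(q)` — equivalently, `α^{1+p^l} + β^{1+p^l} ≠ 0` for every basis
`{α,β}` of `GF(q²)` over `GF(q)` — iff either (a) some power of two divides `p^r - 1`
but not `p^l + 1` and `gcd(p^l+1, p^r+1) = 2`, or (b) every power of two dividing
`p^{2r} - 1` divides `p^l + 1`. -/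
theorem stmt_14 (p r l : ℕ) (hp : p.Prime) (hodd : Odd p) (hr : 0 < r)
    (K L : Type) [Field K] [Field L] [Fintype K] [Fintype L] [Algebra K L]
    (hK : Fintype.card K = p ^ r) (hL : Fintype.card L = (p ^ r) ^ 2) :
    ((∀ x : L, x ^ (1 + p ^ l) + 1 = 0 → x ∈ Set.range (algebraMap K L)) ↔
        (((∃ t : ℕ, 2 ^ t ∣ p ^ r - 1 ∧ ¬ 2 ^ t ∣ p ^ l + 1) ∧
            Nat.gcd (p ^ l + 1) (p ^ r + 1) = 2) ∨
          (∀ t : ℕ, 2 ^ t ∣ p ^ (2 * r) - 1 → 2 ^ t ∣ p ^ l + 1))) ∧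
    ((∀ α β : L, LinearIndependent K ![α, β] →
        α ^ (1 + p ^ l) + β ^ (1 + p ^ l) ≠ 0) ↔
      (((∃ t : ℕ, 2 ^ t ∣ p ^ r - 1 ∧ ¬ 2 ^ t ∣ p ^ l + 1) ∧
          Nat.gcd (p ^ l + 1) (p ^ r + 1) = 2) ∨
        (∀ t : ℕ, 2 ^ t ∣ p ^ (2 * r) - 1 → 2 ^ t ∣ p ^ l + 1))) := by
  rw [add_pow_ne_zero_of_linearIndependent_iff, and_self]
  have h := roots_mem_range_iff (K := K) (L := L) (n := p ^ l + 1) (hodd.pow (n := r))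
    (hodd.pow.add_one) (Nat.succ_ne_zero _) hK hL
  rw [mul_comm 2 r, pow_mul, ← h, add_comm 1]
  simp only [eq_neg_iff_add_eq_zero]
end

section
/- Let p be a prime, q = p^r, and l ≥ 1 an integer. If there is a power of two which divides r but does not divide l, then every root of the equation X^{1+p^l} + 1 = 0 lying in GF(q²) lies in GF(q); equivalently, the power sum α^{1+p^l} + β^{1+p^l} is nonzero for every basis {α,β} of GF(q²) over GF(q). -/
theorem two_mul_gcd_dvd_of_two_pow {r l t : ℕ} (hr : 2 ^ t ∣ r) (hl : ¬ 2 ^ t ∣ l) :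
    2 * Nat.gcd l r ∣ r := by
  obtain ⟨k, hk⟩ := Nat.gcd_dvd_right l r
  rcases Nat.even_or_odd k with ⟨m, rfl⟩ | hodd
  · exact ⟨m, by linarith⟩
  · refine absurd (Dvd.dvd.trans ?_ (Nat.gcd_dvd_left l r)) hl
    exact ((Nat.coprime_two_left.2 hodd).pow_left t).dvd_of_dvd_mul_right (hk ▸ hr)

theorem pow_prime_pow_two_mul_eq_self {L : Type*} [Field L] {p l : ℕ} [ExpChar L p] {x : L}
    (hx : x ^ (1 + p ^ l) + 1 = 0) : x ^ p ^ (2 * l) = x := by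
  have hx0 : x ≠ 0 := by
    rintro rfl
    simp at hx
  have h1 : x * x ^ p ^ l = -1 := by
    rw [← pow_succ', add_comm]
    exact eq_neg_of_add_eq_zero_left hx
  have h2 : x ^ p ^ l * x ^ p ^ (2 * l) = -1 := by
    have h := congrArg (iterateFrobenius L p l) h1
    rwa [map_mul, map_neg, map_one, iterateFrobenius_def, iterateFrobenius_def, ← pow_mul x,
      ← pow_add p, ← two_mul] at h
  refine mul_left_cancel₀ (pow_ne_zero (p ^ l) hx0) ?_
  rw [h2, ← h1, mul_comm]

/-- Proposition 6 of the paper.  `p` prime, `q = p^r`, `K = GF(q)`,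
`L = GF(q²)`, `l ≥ 1`.  If some power of two divides `r` but not `l`, then every root
of `X^{1+p^l} + 1 = 0` lying in `GF(q²)` lies in `GF(q)`; equivalently,
`α^{1+p^l} + β^{1+p^l} ≠ 0` for every basis `{α,β}` of `GF(q²)` over `GF(q)`. -/
theorem stmt_15 (p r l : ℕ) (hp : p.Prime) (hr : 0 < r) (hl : 1 ≤ l)
    (h2 : ∃ t : ℕ, 2 ^ t ∣ r ∧ ¬ 2 ^ t ∣ l)
    (K L : Type) [Field K] [Field L] [Fintype K] [Fintype L] [Algebra K L]
    (hK : Fintype.card K = p ^ r) (hL : Fintype.card L = (p ^ r) ^ 2) :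
    (∀ x : L, x ^ (1 + p ^ l) + 1 = 0 → x ∈ Set.range (algebraMap K L)) ∧
    (∀ α β : L, LinearIndependent K ![α, β] →
      α ^ (1 + p ^ l) + β ^ (1 + p ^ l) ≠ 0) := by
  obtain ⟨t, htr, htl⟩ := h2
  have : Fact p.Prime := ⟨hp⟩
  have hchar : CharP L p := by
    refine charP_of_card_eq_prime_pow (f := r * 2) ?_
    rw [pow_mul, hL]
  have hroot : ∀ x : L, x ^ (1 + p ^ l) + 1 = 0 → x ∈ Set.range (algebraMap K L) := by
    intro x hx
    have hfix (n : ℕ) : Function.IsPeriodicPt (fun y : L => y ^ p) n x ↔ x ^ p ^ n = x := by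
      rw [Function.IsPeriodicPt, pow_iterate, Function.IsFixedPt]
    have hl' := (hfix (2 * l)).2 (pow_prime_pow_two_mul_eq_self hx)
    have hr' : Function.IsPeriodicPt (fun y : L => y ^ p) (2 * r) x := by
      rw [hfix, mul_comm, pow_mul, ← hL, FiniteField.pow_card]
    have hg := hl'.gcd hr'
    rw [Nat.gcd_mul_left] at hg
    apply mem_range_algebraMap_of_pow_card_eq
    rw [hK, ← hfix]
    exact hg.trans_dvd (two_mul_gcd_dvd_of_two_pow htr htl)
  refine ⟨hroot, fun α β hind h => ?_⟩
  have hβ : β ≠ 0 := hind.ne_zero 1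
  obtain ⟨c, hc⟩ := hroot (α / β) (by
    rw [div_pow, div_add_one (pow_ne_zero _ hβ), h, zero_div])
  have hlin : (1 : K) • α + (-c) • β = 0 := by
    rw [Algebra.smul_def, Algebra.smul_def, map_neg, hc, map_one]
    field_simp
    ring
  exact one_ne_zero (LinearIndependent.pair_iff.1 hind 1 (-c) hlin).1
end

section
/- Let C be the cyclic code of length n over GF(q^m) (with n | q^m − 1) with zero set Z and nonzero set S = {0,…,n−1} \ Z. For 0 ≤ s ≤ n−1 let C_s denote the cyclotomic coset of s modulo n under multiplication by q. Then Tr(C), the coordinatewise trace of C, is the cyclic code of length n over GF(q) whose nonzero set is S^c = ∪_{s∈S} C_s and whose zero set is Z^c = ∪_{{s : C_s ⊆ Z}} C_s. -/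
/-- The reduction of `s` modulo `n` is recovered from that of `s * q ^ k` by a further power of `q`. -/
theorem mod_mul_pow_mul_pow_mod {q m n : ℕ} (hm : 0 < m) (hqm : q ^ m ≡ 1 [MOD n]) (s k : ℕ) :
    ((s * q ^ k) % n) * q ^ (k * (m - 1)) % n = s % n := by
  have h : s * q ^ k * q ^ (k * (m - 1)) = s * (q ^ m) ^ k := by
    obtain ⟨m, rfl⟩ := Nat.exists_eq_add_of_lt hm
    simp only [zero_add, Nat.add_sub_cancel]
    rw [← pow_mul, mul_assoc, ← pow_add]
    ring_nf
  rw [Nat.mod_mul_mod, h]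
  simpa [Nat.ModEq] using (hqm.pow k).mul_left s

/-- Orthogonality of the characters `j ↦ α ^ (i * j)` of `ℤ / n`. -/
theorem sum_pow_mul_inv_pow_orderOf {L : Type*} [Field L] {α : L} {n : ℕ} (hα : orderOf α = n)
    (hn : 0 < n) (a b : ℕ) :
    ∑ j : Fin n, α ^ (a * (j : ℕ)) * α⁻¹ ^ (b * (j : ℕ)) = if a % n = b % n then (n : L) else 0 := by
  have hα0 : α ≠ 0 := by
    rintro rfl
    simp at hα
    omega
  have hαn : α ^ n = 1 := hα ▸ pow_orderOf_eq_one α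
  simp only [pow_mul, ← mul_pow]
  rw [Fin.sum_univ_eq_sum_range (fun j => (α ^ a * α⁻¹ ^ b) ^ j) n]
  have hx : α ^ a * α⁻¹ ^ b = 1 ↔ a % n = b % n := by
    rw [inv_pow, mul_inv_eq_one₀ (pow_ne_zero _ hα0), ← hα]
    have := pow_eq_pow_iff_modEq (x := Units.mk0 α hα0) (n := a) (m := b)
    rw [← orderOf_units, Units.ext_iff] at this
    simpa [Nat.ModEq] using this
  split_ifs with h
  · simp only [hx.2 h, one_pow, Finset.sum_const, Finset.card_range, nsmul_one]
  · rw [geom_sum_eq (fun h' => h (hx.1 h')), mul_pow, ← pow_mul, ← pow_mul, mul_comm a, mul_comm b,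
      pow_mul, pow_mul, inv_pow, hαn]
    simp

section Frobenius

variable {K L : Type*} [Field K] [Field L] [Fintype K] [Fintype L] [Algebra K L]

theorem frobeniusAlgEquivOfAlgebraic_pow_apply (x : L) (k : ℕ) :
    (FiniteField.frobeniusAlgEquivOfAlgebraic K L ^ k) x = x ^ Fintype.card K ^ k := by
  rw [AlgEquiv.coe_pow, FiniteField.coe_frobeniusAlgEquivOfAlgebraic_iterate]

theorem sum_pow_card_pow (K : Type*) [Field K] [Fintype K] [Algebra K L] {ι : Type*} (s : Finset ι)
    (f : ι → L) (k : ℕ) :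
    (∑ i ∈ s, f i) ^ Fintype.card K ^ k = ∑ i ∈ s, f i ^ Fintype.card K ^ k := by
  simp only [← frobeniusAlgEquivOfAlgebraic_pow_apply, map_sum]

theorem trace_pow_card_pow (x : L) (k : ℕ) :
    Algebra.trace K L (x ^ Fintype.card K ^ k) = Algebra.trace K L x := by
  rw [← frobeniusAlgEquivOfAlgebraic_pow_apply]
  exact Algebra.trace_eq_of_algEquiv _ _

end Frobenius

/-- Proposition 7 of the paper, via Delsarte's theorem.
`K = GF(q)`, `L = GF(q^m)`, `n ∣ q^m - 1`, `α` a primitive `n`-th root of unity in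
`L`, and `C` the cyclic code of length `n` over `L` with zero set `Z` (a subset of
`{0,…,n-1}`), i.e. `C = {c : Σ_j c_j α^{ij} = 0 for all i ∈ Z}`.  Then `Tr(C)` is the
cyclic code of length `n` over `K` whose zero set is
`Z^c = {i < n : C_i ⊆ Z} = ∪_{C_s ⊆ Z} C_s` (where `C_s = {s q^k mod n}` is the
cyclotomic coset of `s`), and whose nonzero set is `S^c = ∪_{s ∈ S} C_s`, the
complement of `Z^c` in `{0,…,n-1}` (`S = {0,…,n-1} \ Z`). -/
theorem stmt_18 (q m n : ℕ) (hq : IsPrimePow q) (hm : 0 < m) (hn : 0 < n)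
    (hdvd : n ∣ q ^ m - 1)
    (K L : Type) [Field K] [Field L] [Fintype K] [Fintype L] [Algebra K L]
    (hK : Fintype.card K = q) (hL : Fintype.card L = q ^ m)
    (α : L) (hα : orderOf α = n)
    (Z : Set ℕ) (hZ : ∀ s ∈ Z, s < n) :
    ((fun c : Fin n → L => fun j : Fin n => Algebra.trace K L (c j)) ''
        {c : Fin n → L | ∀ i : ℕ, i < n → i ∈ Z →
          ∑ j : Fin n, c j * α ^ (i * (j : ℕ)) = 0} =
      {d : Fin n → K | ∀ i : ℕ, i < n → (∀ k : ℕ, (i * q ^ k) % n ∈ Z) →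
          ∑ j : Fin n, algebraMap K L (d j) * α ^ (i * (j : ℕ)) = 0}) ∧
    ({t : ℕ | t < n ∧ ∃ s : ℕ, s < n ∧ s ∉ Z ∧ ∃ k : ℕ, t = (s * q ^ k) % n} =
      {t : ℕ | t < n ∧ ¬ (∀ k : ℕ, (t * q ^ k) % n ∈ Z)}) := by
  subst hK
  have hqm : Fintype.card K ^ m ≡ 1 [MOD n] :=
    ((Nat.modEq_iff_dvd' (Nat.one_le_pow _ _ Fintype.card_pos)).2 hdvd).symm
  have hpow {a b : ℕ} (h : a % n = b % n) (j : ℕ) : α ^ (a * j) = α ^ (b * j) := by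
    rw [← pow_mod_orderOf, ← pow_mod_orderOf α (b * j), hα, Nat.mul_mod, h, ← Nat.mul_mod]
  constructor
  · ext d
    constructor
    · rintro ⟨c, hc, rfl⟩ i - hi
      simp only [FiniteField.algebraMap_trace_eq_sum_pow, Finset.sum_mul]
      rw [Finset.sum_comm]
      refine Finset.sum_eq_zero fun k _ => ?_
      have hi' := mod_mul_pow_mul_pow_mod hm hqm i k
      have hik : (i * Fintype.card K ^ (k * (m - 1))) % n * Fintype.card K ^ k % n = i % n := by
        rw [← hi', Nat.mod_mul_mod, Nat.mod_mul_mod]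
        ring_nf
      have := hc _ (Nat.mod_lt _ hn) (hi (k * (m - 1)))
      apply_fun (· ^ Fintype.card K ^ k) at this
      rw [sum_pow_card_pow K, zero_pow (pow_ne_zero _ Fintype.card_ne_zero)] at this
      rw [← this]
      refine Finset.sum_congr rfl fun j _ => ?_
      rw [mul_pow, ← pow_mul, mul_right_comm, hpow hik, Nat.card_eq_fintype_card]
    · intro hd
      have hnK : (n : K) ≠ 0 := by
        intro h0
        have h1 : ((Fintype.card K ^ m - 1 : ℕ) : K) = 0 := by
          obtain ⟨r, hr⟩ := hdvd
          rw [hr, Nat.cast_mul, h0, zero_mul]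
        rw [Nat.cast_sub (Nat.one_le_pow _ _ Fintype.card_pos)] at h1
        simp [hm.ne'] at h1
      obtain ⟨θ, hθ⟩ := Algebra.trace_surjective K L (n : K)⁻¹
      let D : ℕ → L := fun i => ∑ j : Fin n, algebraMap K L (d j) * α ^ (i * (j : ℕ))
      have hex (i : ℕ) (hi : i < n) (hDi : D i ≠ 0) :
          ∃ k : ℕ, (i * Fintype.card K ^ k) % n ∉ Z := by
        by_contra! h
        exact hDi (hd i hi h)
      choose! e he using hex
      let c : Fin n → L := fun j => ∑ i : Fin n,
        (θ * D i * α⁻¹ ^ ((i : ℕ) * (j : ℕ))) ^ Fintype.card K ^ e i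
      refine ⟨c, fun t ht htZ => ?_, funext fun j => ?_⟩
      · simp only [c, Finset.sum_mul]
        rw [Finset.sum_comm]
        refine Finset.sum_eq_zero fun i _ => ?_
        by_cases hDi : D i = 0
        · simp [hDi, Fintype.card_ne_zero]
        have hti : t % n ≠ (i * Fintype.card K ^ e i) % n := fun h =>
          he i i.2 hDi (by rwa [← h, Nat.mod_eq_of_lt ht])
        have := sum_pow_mul_inv_pow_orderOf hα hn t (i * Fintype.card K ^ e i)
        rw [if_neg hti] at this
        have h0 := congrArg ((θ * D i) ^ Fintype.card K ^ e i * ·) this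
        simp only [Finset.mul_sum, mul_zero] at h0
        refine (Finset.sum_congr rfl fun j _ => ?_).trans h0
        rw [mul_pow, ← pow_mul, mul_right_comm (i : ℕ)]
        ring
      · have hinv : ∑ i : Fin n, D i * α⁻¹ ^ ((i : ℕ) * (j : ℕ)) = n * algebraMap K L (d j) := by
          simp only [D, Finset.sum_mul]
          rw [Finset.sum_comm]
          have (l : Fin n) : ∑ i : Fin n, algebraMap K L (d l) * α ^ ((i : ℕ) * (l : ℕ)) *
              α⁻¹ ^ ((i : ℕ) * (j : ℕ)) = if l = j then n * algebraMap K L (d l) else 0 := by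
            have := sum_pow_mul_inv_pow_orderOf hα hn l j
            rw [Nat.mod_eq_of_lt l.2, Nat.mod_eq_of_lt j.2] at this
            simp only [mul_assoc, ← Finset.mul_sum, mul_comm _ (l : ℕ), mul_comm _ (j : ℕ), this,
              Fin.val_inj]
            split_ifs <;> ring
          simp only [this, Finset.sum_ite_eq', Finset.mem_univ, if_true]
        have hc : ∑ i : Fin n, θ * D i * α⁻¹ ^ ((i : ℕ) * (j : ℕ)) = ((n : K) * d j) • θ := by
          simp only [mul_assoc, ← Finset.mul_sum, hinv, Algebra.smul_def, map_mul, map_natCast]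
          ring
        simp only [c, map_sum, trace_pow_card_pow]
        rw [← map_sum, hc, map_smul, hθ, smul_eq_mul]
        field_simp
  · ext t
    refine and_congr_right fun ht => ?_
    push Not
    constructor
    · rintro ⟨s, hs, hsZ, k, rfl⟩
      refine ⟨k * (m - 1), ?_⟩
      rwa [mod_mul_pow_mul_pow_mod hm hqm, Nat.mod_eq_of_lt hs]
    · rintro ⟨k, hk⟩
      refine ⟨_, Nat.mod_lt _ hn, hk, k * (m - 1), ?_⟩
      rw [mod_mul_pow_mul_pow_mod hm hqm, Nat.mod_eq_of_lt ht]
end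

section
/- Let C be the cyclic code of length n over GF(q^m) (with q = p^r, p prime, n | q^m − 1) with zero set Z and nonzero set S, and let l ≥ 0. Then the following are equivalent: (1) C is self-orthogonal with respect to the form Σ_{i=1}^n x_i y_i^{p^l}; (2) (−p^l S) mod n ⊆ Z; (3) (−p^{−l} S) mod n ⊆ Z, where p^{−l} denotes the inverse of p^l modulo n. -/
theorem toNat_neg_emod_mem_iff {n : ℕ} (hn : 0 < n) (Z : Set ℕ) (a : ℕ) :
    ((-(a : ℤ)) % (n : ℤ)).toNat ∈ Z ↔ ∀ t < n, t ∉ Z → ¬ n ∣ t + a := by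
  have hn' : (0 : ℤ) < n := by exact_mod_cast hn
  have h0 : 0 ≤ (-(a : ℤ)) % n := Int.emod_nonneg _ hn'.ne'
  have h1 : (-(a : ℤ)) % n < n := Int.emod_lt_of_pos _ hn'
  constructor
  · intro h t ht htZ hd
    apply htZ
    convert h
    have : (t : ℤ) % n = (-(a : ℤ)) % n := by
      apply Int.ModEq.symm
      rw [Int.modEq_iff_dvd, sub_neg_eq_add]
      exact_mod_cast hd
    rw [← this]
    have h2 : (t : ℤ) % n = t := Int.emod_eq_of_lt (by positivity) (by exact_mod_cast ht)
    rw [h2, Int.toNat_natCast]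
  · intro h
    by_contra hZ
    refine h _ (by omega) hZ ?_
    rw [← Int.natCast_dvd_natCast]
    push_cast
    rw [Int.toNat_of_nonneg h0, ← sub_neg_eq_add]
    exact (Int.mod_modEq _ _).symm.dvd

theorem forall_toNat_neg_mul_emod_mem_iff {n : ℕ} (hn : 0 < n) (Z : Set ℕ) (a : ℕ) :
    (∀ s < n, s ∉ Z → ((-((a : ℤ) * s)) % (n : ℤ)).toNat ∈ Z) ↔
      ∀ s < n, s ∉ Z → ∀ t < n, t ∉ Z → ¬ n ∣ t + a * s := by
  refine forall_congr' fun s => forall_congr' fun _ => forall_congr' fun _ => ?_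
  rw [← toNat_neg_emod_mem_iff hn, Nat.cast_mul]

theorem dvd_add_mul_comm_of_mul_modEq_one {n e u s t : ℕ} (h : e * u ≡ 1 [MOD n])
    (hd : n ∣ t + u * s) : n ∣ s + e * t := by
  have h1 : e * (t + u * s) ≡ s + e * t [MOD n] := by
    have := (h.mul_right s).add_right (e * t)
    convert this using 1 <;> ring
  exact (h1.dvd_iff dvd_rfl).1 (hd.mul_left e)

theorem sum_fin_pow_of_pow_eq_one {L : Type*} [Field L] {n : ℕ} {β : L} (h1 : β ≠ 1)
    (hβ : β ^ n = 1) : ∑ j : Fin n, β ^ (j : ℕ) = 0 := by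
  rw [Fin.sum_univ_eq_sum_range (fun j => β ^ j), geom_sum_eq h1, hβ, sub_self, zero_div]

theorem pow_mul_inv_pow_eq_one_iff {L : Type*} [Field L] {n : ℕ} (hn : 0 < n) {α : L}
    (hα : orderOf α = n) (i j : Fin n) :
    α ^ (i : ℕ) * α⁻¹ ^ (j : ℕ) = 1 ↔ i = j := by
  have h0 : α ≠ 0 := by
    rintro rfl
    simp at hα
    omega
  rw [inv_pow, mul_inv_eq_one₀ (pow_ne_zero _ h0), Fin.ext_iff]
  refine ⟨fun h => pow_injOn_Iio_orderOf ?_ ?_ h, fun h => by rw [h]⟩ <;> simp [hα]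

theorem sum_fourier_mul_inv_pow {L : Type*} [Field L] {n : ℕ} (hn : 0 < n) {α : L}
    (hα : orderOf α = n) (y : Fin n → L) (j : Fin n) :
    ∑ t : Fin n, (∑ k : Fin n, y k * α ^ ((t : ℕ) * (k : ℕ))) * α⁻¹ ^ ((t : ℕ) * (j : ℕ)) =
      n * y j := by
  have hpow : α ^ n = 1 := hα ▸ pow_orderOf_eq_one α
  calc _ = ∑ k : Fin n, y k * ∑ t : Fin n, (α ^ (k : ℕ) * α⁻¹ ^ (j : ℕ)) ^ (t : ℕ) := by
        simp_rw [Finset.sum_mul, Finset.mul_sum]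
        rw [Finset.sum_comm]
        refine Finset.sum_congr rfl fun k _ => Finset.sum_congr rfl fun t _ => ?_
        rw [mul_pow, ← pow_mul, ← pow_mul, mul_assoc, mul_comm (t : ℕ), mul_comm (t : ℕ)]
    _ = n * y j := by
        rw [Finset.sum_eq_single j]
        · rw [(pow_mul_inv_pow_eq_one_iff hn hα j j).2 rfl]
          simp [mul_comm]
        · intro k _ hk
          rw [sum_fin_pow_of_pow_eq_one, mul_zero]
          · exact fun h => hk ((pow_mul_inv_pow_eq_one_iff hn hα k j).1 h)
          · rw [mul_pow, pow_right_comm, pow_right_comm α⁻¹, inv_pow, hpow]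
            simp
        · simp

theorem cyclicCode_selfOrthogonal_iff {L : Type*} [Field L] {p n : ℕ} [Fact p.Prime] [CharP L p]
    (l : ℕ) (hn : 0 < n) (hn0 : (n : L) ≠ 0) {α : L} (hα : orderOf α = n) (Z : Set ℕ)
    (C : Set (Fin n → L))
    (hC : C = {c : Fin n → L | ∀ i : ℕ, i < n → i ∈ Z →
      ∑ j : Fin n, c j * α ^ (i * (j : ℕ)) = 0}) :
    (∀ x ∈ C, ∀ y ∈ C, ∑ i : Fin n, x i * y i ^ p ^ l = 0) ↔
      ∀ s < n, s ∉ Z → ∀ t < n, t ∉ Z → ¬ n ∣ t + p ^ l * s := by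
  have hpow : α ^ n = 1 := hα ▸ pow_orderOf_eq_one α
  subst hC
  constructor
  · intro h s hs hsZ t ht htZ hd
    have hmem : ∀ s < n, s ∉ Z → (fun j : Fin n => α⁻¹ ^ (s * (j : ℕ))) ∈
        {c : Fin n → L | ∀ i : ℕ, i < n → i ∈ Z →
          ∑ j : Fin n, c j * α ^ (i * (j : ℕ)) = 0} := by
      intro s hs hsZ i hi hiZ
      have hne : α ^ i * α⁻¹ ^ s ≠ 1 := fun h' => by
        have := (pow_mul_inv_pow_eq_one_iff hn hα ⟨i, hi⟩ ⟨s, hs⟩).1 h'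
        rw [Fin.mk.injEq] at this
        exact hsZ (this ▸ hiZ)
      rw [← sum_fin_pow_of_pow_eq_one (n := n) hne]
      · refine Finset.sum_congr rfl fun j _ => ?_
        rw [mul_pow, ← pow_mul, ← pow_mul, mul_comm]
      · rw [mul_pow, pow_right_comm, pow_right_comm α⁻¹, inv_pow, hpow]
        simp
    have := h _ (hmem t ht htZ) _ (hmem s hs hsZ)
    apply hn0
    rw [← this]
    symm
    obtain ⟨d, hd⟩ := hd
    calc _ = ∑ _j : Fin n, (1 : L) := by
          refine Finset.sum_congr rfl fun j _ => ?_
          rw [← pow_mul, ← pow_add, show t * (j : ℕ) + s * j * p ^ l = n * (d * j) by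
            rw [← mul_assoc, ← hd]; ring, pow_mul, inv_pow, hpow]
          simp
      _ = n := by simp
  · intro h x hx y hy
    refine (mul_eq_zero.1 ?_).resolve_left (pow_ne_zero (p ^ l) hn0)
    calc (n : L) ^ p ^ l * ∑ j : Fin n, x j * y j ^ p ^ l
        = ∑ t : Fin n, (∑ k : Fin n, y k * α ^ ((t : ℕ) * (k : ℕ))) ^ p ^ l *
            ∑ j : Fin n, x j * α⁻¹ ^ ((t : ℕ) * (j : ℕ) * p ^ l) := by
          simp_rw [Finset.mul_sum]
          rw [Finset.sum_comm]
          refine Finset.sum_congr rfl fun j _ => ?_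
          rw [mul_left_comm, ← mul_pow, ← sum_fourier_mul_inv_pow hn hα, sum_pow_char_pow,
            Finset.mul_sum]
          refine Finset.sum_congr rfl fun t _ => ?_
          rw [mul_pow, ← pow_mul, mul_left_comm]
      _ = 0 := by
          refine Finset.sum_eq_zero fun t _ => ?_
          by_cases htZ : (t : ℕ) ∈ Z
          · rw [hy t t.2 htZ, zero_pow (pow_ne_zero l (Fact.out : p.Prime).ne_zero), zero_mul]
          · obtain ⟨s, hs, hsZ, d, hd⟩ : ∃ s < n, s ∈ Z ∧ n ∣ s + p ^ l * t := by
              have hlt := Nat.mod_lt (p ^ l * t) hn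
              have hdvd : n ∣ (n - p ^ l * t % n) % n + p ^ l * t := by
                rw [Nat.dvd_iff_mod_eq_zero, Nat.add_mod, Nat.mod_mod, ← Nat.add_mod,
                  ← Nat.add_mod_mod, Nat.sub_add_cancel hlt.le, Nat.mod_self]
              refine ⟨_, Nat.mod_lt _ hn, ?_, hdvd⟩
              by_contra hsZ
              exact h t t.2 htZ _ (Nat.mod_lt _ hn) hsZ hdvd
            rw [← mul_zero ((∑ k : Fin n, y k * α ^ ((t : ℕ) * (k : ℕ))) ^ p ^ l),
              ← hx s hs hsZ]
            congr 1
            refine Finset.sum_congr rfl fun j _ => ?_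
            rw [inv_pow, inv_eq_of_mul_eq_one_left]
            rw [← pow_add, show s * (j : ℕ) + t * j * p ^ l = n * (d * j) by
              rw [← mul_assoc, ← hd]; ring, pow_mul, hpow, one_pow]

/-- Proposition 8 of the paper.  `L = GF(q^m)` with `q = p^r`,
`n ∣ q^m - 1`, `α` a primitive `n`-th root of unity in `L`, and `C` the cyclic code
of length `n` over `L` with zero set `Z ⊆ {0,…,n-1}` and nonzero set
`S = {0,…,n-1} \ Z`.  Then the following are equivalent:
(1) `C` is self-orthogonal w.r.t. the form `Σ_i x_i y_i^{p^l}`;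
(2) `(-p^l S) mod n ⊆ Z`;
(3) `(-p^{-l} S) mod n ⊆ Z`, where `p^{-l}` is the inverse of `p^l` modulo `n`. -/
theorem stmt_19 (p r m n l : ℕ) (hp : p.Prime) (hr : 0 < r) (hm : 0 < m) (hn : 0 < n)
    (hdvd : n ∣ (p ^ r) ^ m - 1)
    (L : Type) [Field L] [Fintype L] (hL : Fintype.card L = (p ^ r) ^ m)
    (α : L) (hα : orderOf α = n)
    (Z : Set ℕ) (hZ : ∀ s ∈ Z, s < n)
    (C : Set (Fin n → L))
    (hCdef : C = {c : Fin n → L | ∀ i : ℕ, i < n → i ∈ Z →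
      ∑ j : Fin n, c j * α ^ (i * (j : ℕ)) = 0}) :
    ((∀ x ∈ C, ∀ y ∈ C, ∑ i : Fin n, x i * y i ^ p ^ l = 0) ↔
      (∀ s : ℕ, s < n → s ∉ Z → ((-(((p : ℤ) ^ l) * s)) % (n : ℤ)).toNat ∈ Z)) ∧
    ((∀ x ∈ C, ∀ y ∈ C, ∑ i : Fin n, x i * y i ^ p ^ l = 0) ↔
      (∀ u : ℕ, (p ^ l * u) % n = 1 % n →
        ∀ s : ℕ, s < n → s ∉ Z → ((-((u : ℤ) * s)) % (n : ℤ)).toNat ∈ Z)) := by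
  have : Fact p.Prime := ⟨hp⟩
  have hchar : CharP L p := by
    obtain ⟨c, hc⟩ := CharP.exists L
    obtain ⟨k, hcp, hk⟩ := FiniteField.card L c
    have hd : c ∣ (p ^ r) ^ m := by
      rw [← hL, hk]
      exact dvd_pow_self c k.ne_zero
    rwa [← (Nat.prime_dvd_prime_iff_eq hcp hp).1 (hcp.dvd_of_dvd_pow (hcp.dvd_of_dvd_pow hd))]
  have hpn : ¬ p ∣ n := fun h => by
    have h1 : p ∣ (p ^ r) ^ m := dvd_pow (dvd_pow_self p hr.ne') hm.ne'
    have h2 : 1 ≤ (p ^ r) ^ m := Nat.one_le_pow _ _ (pow_pos hp.pos r)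
    exact hp.one_lt.ne' (Nat.dvd_one.1 ((Nat.dvd_sub_iff_right h2 h1).1 (h.trans hdvd)))
  have hn0 : (n : L) ≠ 0 := fun h => hpn ((CharP.cast_eq_zero_iff L p n).1 h)
  rw [cyclicCode_selfOrthogonal_iff l hn hn0 hα Z C hCdef]
  refine ⟨by simpa only [Nat.cast_pow] using
    (forall_toNat_neg_mul_emod_mem_iff hn Z (p ^ l)).symm, ?_⟩
  simp_rw [forall_toNat_neg_mul_emod_mem_iff hn Z]
  constructor
  · intro h u hu s hs hsZ t ht htZ hd
    exact h t ht htZ s hs hsZ (dvd_add_mul_comm_of_mul_modEq_one hu hd)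
  · intro h s hs hsZ t ht htZ hd
    obtain ⟨u, -, hu⟩ := Nat.exists_mul_mod_eq_of_coprime 1
      (Nat.Coprime.pow_left l (hp.coprime_iff_not_dvd.2 hpn)) hn.ne'
    exact h u hu t ht htZ s hs hsZ (dvd_add_mul_comm_of_mul_modEq_one (mul_comm u _ ▸ hu) hd)
end
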